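/- Let n, d ≥ 1, k ≥ 0 and C > 0, and let f : ℝ^n → ℝ^d satisfy |f(x)| ≤ C (1 + |x|^k) and |f(x) − f(y)| ≤ C (1 + |x|^k + |y|^k) |x − y| for all x, y ∈ ℝ^n. Then there exists a constant C' > 0 such that for every integer m ≥ 1 there exists an infinitely differentiable function f_m : ℝ^n → ℝ^d with, for all x ∈ ℝ^n: |f(x) − f_m(x)| ≤ C' (1 + |x|^k) m^{−1}, ‖D f_m(x)‖ ≤ C' (1 + |x|^k), and ‖D^2 f_m(x)‖ ≤ C' (1 + |x|^k) m. -/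

import Mathlib

section Mollification

open MeasureTheory Convolution

variable {E F : Type*} [NormedAddCommGroup E] [NormedAddCommGroup F]

/-- A function that is locally Lipschitz with polynomially growing constant is continuous. -/
lemma continuous_of_norm_sub_le_pow_mul {f : E → F} {C : ℝ} {k : ℕ}
    (hf : ∀ x y, ‖f x - f y‖ ≤ C * (1 + ‖x‖ ^ k + ‖y‖ ^ k) * ‖x - y‖) : Continuous f := by
  refine continuous_iff_continuousAt.2 fun y ↦ tendsto_iff_norm_sub_tendsto_zero.2 ?_
  refine squeeze_zero (fun _ ↦ norm_nonneg _) (fun x ↦ hf x y) ?_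
  have h : Continuous fun x ↦ C * (1 + ‖x‖ ^ k + ‖y‖ ^ k) * ‖x - y‖ := by fun_prop
  simpa using h.tendsto y

/-- A locally Lipschitz bound with polynomial growth, made uniform on balls of radius at most one. -/
lemma norm_sub_le_of_mem_closedBall {f : E → F} {C : ℝ} (hC : 0 ≤ C) {k : ℕ}
    (hf : ∀ x y, ‖f x - f y‖ ≤ C * (1 + ‖x‖ ^ k + ‖y‖ ^ k) * ‖x - y‖)
    {x z : E} {δ : ℝ} (hδ : δ ≤ 1) (hz : z ∈ Metric.closedBall x δ) :
    ‖f z - f x‖ ≤ C * (2 ^ k + 1) * (1 + ‖x‖ ^ k) * δ := by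
  rw [mem_closedBall_iff_norm] at hz
  have hzx : ‖z‖ ≤ ‖x‖ + 1 := by
    have := norm_le_norm_add_norm_sub' z x
    linarith
  have hpow : ‖z‖ ^ k ≤ 2 ^ k * (1 + ‖x‖ ^ k) := calc
    ‖z‖ ^ k ≤ (‖x‖ + 1) ^ k := by gcongr
    _ ≤ 2 ^ (k - 1) * (‖x‖ ^ k + 1 ^ k) := add_pow_le (norm_nonneg _) zero_le_one k
    _ ≤ 2 ^ k * (‖x‖ ^ k + 1 ^ k) := by gcongr <;> simp
    _ = 2 ^ k * (1 + ‖x‖ ^ k) := by rw [one_pow, add_comm]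
  calc ‖f z - f x‖ ≤ C * (1 + ‖z‖ ^ k + ‖x‖ ^ k) * ‖z - x‖ := hf z x
    _ ≤ C * ((2 ^ k + 1) * (1 + ‖x‖ ^ k)) * δ := by
      gcongr
      linarith
    _ = C * (2 ^ k + 1) * (1 + ‖x‖ ^ k) * δ := by ring

/-- A convolution is bounded at `y` by a bound of the second factor on the unit ball around `y`, if
the first factor is supported in the unit ball. -/
lemma norm_convolution_le_of_forall_norm_le [MeasurableSpace E] {μ : Measure E}
    {V W : Type*} [NormedAddCommGroup V] [NormedSpace ℝ V]
    [NormedAddCommGroup W] [NormedSpace ℝ W] [NormedSpace ℝ F]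
    (B : V →L[ℝ] F →L[ℝ] W) {ψ : E → V} (hψ : Integrable ψ μ)
    (hψs : Function.support ψ ⊆ Metric.closedBall 0 1) {g : E → F} {y : E} {L : ℝ}
    (hg : ∀ z ∈ Metric.closedBall y 1, ‖g z‖ ≤ L) :
    ‖(ψ ⋆[B, μ] g) y‖ ≤ ‖B‖ * (∫ t, ‖ψ t‖ ∂μ) * L := by
  rw [convolution_def, ← integral_const_mul, ← integral_mul_const]
  refine norm_integral_le_of_norm_le ((hψ.norm.const_mul _).mul_const _) (.of_forall fun t ↦ ?_)
  by_cases ht : ψ t = 0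
  · simp [ht]
  · have h_ball : ‖t‖ ≤ 1 := by simpa using hψs ht
    calc ‖B (ψ t) (g (y - t))‖ ≤ ‖B‖ * ‖ψ t‖ * ‖g (y - t)‖ := B.le_opNorm₂ _ _
      _ ≤ ‖B‖ * ‖ψ t‖ * L := by
        gcongr
        exact hg _ (by simpa [dist_eq_norm] using h_ball)

variable [NormedSpace ℝ E] [NormedSpace ℝ F]

section

variable [MeasurableSpace E] [BorelSpace E] [FiniteDimensional ℝ E]

set_option maxSynthPendingDepth 3 in
/-- The derivatives of order at most two of a convolution with a fixed smooth bump function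
supported in the unit ball are locally bounded by the other factor. -/
lemma exists_bound_fderiv_convolution (μ : Measure E) [μ.IsAddHaarMeasure] {φ : E → ℝ}
    (hφ : ContDiff ℝ (⊤ : ℕ∞) φ) (hφs : tsupport φ ⊆ Metric.closedBall 0 1) :
    ∃ K : ℝ, 0 < K ∧ ∀ (g : E → F), Continuous g → ∀ (y : E) (L : ℝ), 0 ≤ L →
      (∀ z ∈ Metric.closedBall y 1, ‖g z‖ ≤ L) →
      ‖(φ ⋆[ContinuousLinearMap.lsmul ℝ ℝ, μ] g) y‖ ≤ K * L ∧
      ‖fderiv ℝ (φ ⋆[ContinuousLinearMap.lsmul ℝ ℝ, μ] g) y‖ ≤ K * L ∧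
      ‖fderiv ℝ (fderiv ℝ (φ ⋆[ContinuousLinearMap.lsmul ℝ ℝ, μ] g)) y‖ ≤ K * L := by
  have hc : HasCompactSupport φ := (isCompact_closedBall 0 1).of_isClosed_subset
    (isClosed_tsupport φ) hφs
  have hφ₁ : ContDiff ℝ (⊤ : ℕ∞) (fderiv ℝ φ) := hφ.fderiv_right (by simp)
  have hφ₂ : ContDiff ℝ (⊤ : ℕ∞) (fderiv ℝ (fderiv ℝ φ)) := hφ₁.fderiv_right (by simp)
  have hc₁ := hc.fderiv ℝ
  have hc₂ := hc₁.fderiv ℝ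
  have hs₁ : tsupport (fderiv ℝ φ) ⊆ Metric.closedBall 0 1 := (tsupport_fderiv_subset ℝ).trans hφs
  have hs₂ : tsupport (fderiv ℝ (fderiv ℝ φ)) ⊆ Metric.closedBall 0 1 :=
    (tsupport_fderiv_subset ℝ).trans hs₁
  set B : ℝ →L[ℝ] F →L[ℝ] F := ContinuousLinearMap.lsmul ℝ ℝ
  set B₁ := B.precompL E
  set B₂ := B₁.precompL E
  let a := ‖B‖ * ∫ t, ‖φ t‖ ∂μ
  let b := ‖B₁‖ * ∫ t, ‖fderiv ℝ φ t‖ ∂μ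
  let c := ‖B₂‖ * ∫ t, ‖fderiv ℝ (fderiv ℝ φ) t‖ ∂μ
  have ha₀ : 0 ≤ a := by positivity
  have hb₀ : 0 ≤ b := by positivity
  have hc₀ : 0 ≤ c := by positivity
  refine ⟨a + b + c + 1, by positivity, fun g hg y L hL hgL ↦ ?_⟩
  have hd : fderiv ℝ (φ ⋆[B, μ] g) = fderiv ℝ φ ⋆[B₁, μ] g := funext fun x ↦
    (hc.hasFDerivAt_convolution_left B (hφ.of_le (by norm_cast))
      hg.locallyIntegrable x).fderiv
  have hd₂ : fderiv ℝ (fderiv ℝ φ ⋆[B₁, μ] g) = fderiv ℝ (fderiv ℝ φ) ⋆[B₂, μ] g :=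
    funext fun x ↦ (hc₁.hasFDerivAt_convolution_left B₁ (hφ₁.of_le (by norm_cast))
      hg.locallyIntegrable x).fderiv
  rw [hd, hd₂]
  refine ⟨?_, ?_, ?_⟩
  · refine (norm_convolution_le_of_forall_norm_le B
      (hφ.continuous.integrable_of_hasCompactSupport hc)
      ((subset_tsupport _).trans hφs) hgL).trans ?_
    gcongr
    linarith
  · refine (norm_convolution_le_of_forall_norm_le B₁
      (hφ₁.continuous.integrable_of_hasCompactSupport hc₁)
      ((subset_tsupport _).trans hs₁) hgL).trans ?_
    gcongr
    linarith
  · refine (norm_convolution_le_of_forall_norm_le B₂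
      (hφ₂.continuous.integrable_of_hasCompactSupport hc₂)
      ((subset_tsupport _).trans hs₂) hgL).trans ?_
    gcongr
    linarith

end

/-- Mollification at unit scale: the error and the first two derivatives of a mollified function
are controlled by the oscillation of the function on unit balls. -/
lemma exists_unit_mollification [FiniteDimensional ℝ E] [CompleteSpace F] :
    ∃ K : ℝ, 0 < K ∧ ∀ g : E → F, Continuous g → ∃ h : E → F, ContDiff ℝ (⊤ : ℕ∞) h ∧
      ∀ (y : E) (L : ℝ), 0 ≤ L → (∀ z ∈ Metric.closedBall y 1, ‖g z - g y‖ ≤ L) →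
        ‖h y - g y‖ ≤ K * L ∧ ‖fderiv ℝ h y‖ ≤ K * L ∧ ‖fderiv ℝ (fderiv ℝ h) y‖ ≤ K * L := by
  let _ : MeasurableSpace E := borel E
  have : BorelSpace E := ⟨rfl⟩
  let μ : Measure E := Measure.addHaar
  let bump : ContDiffBump (0 : E) := ⟨1 / 2, 1, by norm_num, by norm_num⟩
  set φ := bump.normed μ
  have hφ : ContDiff ℝ (⊤ : ℕ∞) φ := bump.contDiff_normed
  have hφs : tsupport φ ⊆ Metric.closedBall 0 1 := bump.tsupport_normed_eq.subset
  have hc : HasCompactSupport φ := bump.hasCompactSupport_normed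
  obtain ⟨K, hK, H⟩ := exists_bound_fderiv_convolution (F := F) μ hφ hφs
  refine ⟨K, hK, fun g hg ↦ ⟨φ ⋆[ContinuousLinearMap.lsmul ℝ ℝ, μ] g,
    hc.contDiff_convolution_left _ hφ hg.locallyIntegrable, fun y L hL hgL ↦ ?_⟩⟩
  have h_conv : (φ ⋆[ContinuousLinearMap.lsmul ℝ ℝ, μ] (fun z ↦ g z - g y)) =
      fun x ↦ (φ ⋆[ContinuousLinearMap.lsmul ℝ ℝ, μ] g) x - g y := by
    funext x
    have hi : Integrable (fun t ↦ φ t • g (x - t)) μ :=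
      (hφ.continuous.smul (hg.comp (continuous_const.sub continuous_id))
        ).integrable_of_hasCompactSupport hc.smul_right
    simp only [convolution_def, ContinuousLinearMap.lsmul_apply, smul_sub]
    rw [integral_sub hi (bump.integrable_normed.smul_const _), bump.integral_normed_smul μ]
  have := H (fun z ↦ g z - g y) (hg.sub continuous_const) y L hL hgL
  rw [h_conv, show fderiv ℝ (fun x ↦ (φ ⋆[ContinuousLinearMap.lsmul ℝ ℝ, μ] g) x - g y) =
    fderiv ℝ (φ ⋆[ContinuousLinearMap.lsmul ℝ ℝ, μ] g) from funext fun x ↦ fderiv_sub_const _] at this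
  exact this

set_option maxSynthPendingDepth 3 in
/-- Mollification at scale `r⁻¹`. -/
lemma exists_mollification [FiniteDimensional ℝ E] [CompleteSpace F] :
    ∃ K : ℝ, 0 < K ∧ ∀ f : E → F, Continuous f → ∀ r : ℝ, 0 < r →
      ∃ h : E → F, ContDiff ℝ (⊤ : ℕ∞) h ∧
      ∀ (x : E) (L : ℝ), 0 ≤ L → (∀ z ∈ Metric.closedBall x r⁻¹, ‖f z - f x‖ ≤ L * r⁻¹) →
        ‖f x - h x‖ ≤ K * L * r⁻¹ ∧ ‖fderiv ℝ h x‖ ≤ K * L ∧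
        ‖fderiv ℝ (fderiv ℝ h) x‖ ≤ K * L * r := by
  obtain ⟨K, hK, H⟩ := exists_unit_mollification (E := E) (F := F)
  refine ⟨K, hK, fun f hf r hr ↦ ?_⟩
  obtain ⟨h, hh, hb⟩ := H (fun y ↦ r • f (r⁻¹ • y)) (by fun_prop)
  refine ⟨fun x ↦ r⁻¹ • h (r • x), by fun_prop, fun x L hL hfL ↦ ?_⟩
  obtain ⟨h₀, h₁, h₂⟩ := hb (r • x) L hL fun z hz ↦ by
    have hz' : r⁻¹ • z ∈ Metric.closedBall x r⁻¹ := by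
      rw [mem_closedBall_iff_norm] at hz ⊢
      calc ‖r⁻¹ • z - x‖ = ‖r⁻¹ • (z - r • x)‖ := by rw [smul_sub, inv_smul_smul₀ hr.ne']
        _ = r⁻¹ * ‖z - r • x‖ := by rw [norm_smul, Real.norm_of_nonneg (by positivity)]
        _ ≤ r⁻¹ * 1 := by gcongr
        _ = r⁻¹ := mul_one _
    calc ‖r • f (r⁻¹ • z) - r • f (r⁻¹ • r • x)‖ = r * ‖f (r⁻¹ • z) - f x‖ := by
          rw [inv_smul_smul₀ hr.ne', ← smul_sub, norm_smul, Real.norm_of_nonneg hr.le]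
      _ ≤ r * (L * r⁻¹) := by gcongr; exact hfL _ hz'
      _ = L := by field_simp
  have hd : fderiv ℝ (fun x ↦ r⁻¹ • h (r • x)) = fun x ↦ fderiv ℝ h (r • x) := by
    funext x
    have hh' : Differentiable ℝ h := hh.differentiable (by simp)
    rw [fderiv_fun_const_smul (by fun_prop), fderiv_comp_smul, inv_smul_smul₀ hr.ne']
  refine ⟨?_, by rwa [hd], ?_⟩
  · have : f x - r⁻¹ • h (r • x) = -(r⁻¹ • (h (r • x) - r • f (r⁻¹ • r • x))) := by
      rw [inv_smul_smul₀ hr.ne', smul_sub, inv_smul_smul₀ hr.ne', neg_sub]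
    rw [this, norm_neg, norm_smul, Real.norm_of_nonneg (by positivity), mul_comm]
    gcongr
  · rw [hd, fderiv_comp_smul, norm_smul, Real.norm_of_nonneg hr.le, mul_comm]
    gcongr

end Mollification

/-- Mollification lemma: a locally Lipschitz function of polynomial
growth admits a family of smooth approximations `f_m` with
`|f − f_m| ≲ (1+|x|^k)/m`, `‖Df_m‖ ≲ 1+|x|^k` and `‖D²f_m‖ ≲ (1+|x|^k) m`. -/
theorem mollification_polynomial_growth
    (n d k : ℕ) (hn : 1 ≤ n) (hd : 1 ≤ d) (C : ℝ) (hC : 0 < C)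
    (f : EuclideanSpace ℝ (Fin n) → EuclideanSpace ℝ (Fin d))
    (hf_growth : ∀ x, ‖f x‖ ≤ C * (1 + ‖x‖ ^ k))
    (hf_lip : ∀ x y, ‖f x - f y‖ ≤ C * (1 + ‖x‖ ^ k + ‖y‖ ^ k) * ‖x - y‖) :
    ∃ C' : ℝ, 0 < C' ∧ ∀ m : ℕ, 1 ≤ m →
      ∃ fm : EuclideanSpace ℝ (Fin n) → EuclideanSpace ℝ (Fin d),
        ContDiff ℝ (⊤ : ℕ∞) fm ∧
        (∀ x, ‖f x - fm x‖ ≤ C' * (1 + ‖x‖ ^ k) * (m : ℝ)⁻¹) ∧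
        (∀ x, ‖fderiv ℝ fm x‖ ≤ C' * (1 + ‖x‖ ^ k)) ∧
        (∀ x, ‖fderiv ℝ (fderiv ℝ fm) x‖ ≤ C' * (1 + ‖x‖ ^ k) * (m : ℝ)) := by
  obtain ⟨K, hK, H⟩ := exists_mollification (E := EuclideanSpace ℝ (Fin n))
    (F := EuclideanSpace ℝ (Fin d))
  refine ⟨K * (C * (2 ^ k + 1)), by positivity, fun m hm ↦ ?_⟩
  have hm₁ : (1 : ℝ) ≤ m := by exact_mod_cast hm
  obtain ⟨fm, h_smooth, hb⟩ := H f (continuous_of_norm_sub_le_pow_mul hf_lip) m (by linarith)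
  have hbx (x : EuclideanSpace ℝ (Fin n)) := hb x (C * (2 ^ k + 1) * (1 + ‖x‖ ^ k))
    (by positivity) fun z hz ↦
      norm_sub_le_of_mem_closedBall hC.le hf_lip (inv_le_one_of_one_le₀ hm₁) hz
  simp only [← mul_assoc] at hbx ⊢
  exact ⟨fm, h_smooth, fun x ↦ (hbx x).1, fun x ↦ (hbx x).2.1, fun x ↦ (hbx x).2.2⟩
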